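/- Let T : [0, 3/4] → [0, 3/4] be defined by T(x) = x/3 for x ∈ [0, 1/2] and T(x) = x/3 + 1/4 for x ∈ (1/2, 3/4], and equip [0, 3/4] with the usual distance |x − y|. Then T is a Leader contraction: for each ε > 0 there exist δ > 0 and r ∈ ℕ such that for all x, y ∈ [0, 3/4], |x − y| < ε + δ implies |T^r x − T^r y| < ε. -/

import Mathlib

open Set

/-- The map T(x) = x/3 on [0,1/2] and T(x) = x/3 + 1/4 on (1/2,3/4] (extended to ℝ by
the same formula, splitting at 1/2). -/
noncomputable def leaderMap : ℝ → ℝ :=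
  fun x => if x ≤ 1/2 then x/3 else x/3 + 1/4

theorem leaderMap_mem_Icc {x : ℝ} (hx : x ∈ Icc (0:ℝ) (3/4)) :
    leaderMap x ∈ Icc (0:ℝ) (1/2) := by
  obtain ⟨h0, h1⟩ := hx
  unfold leaderMap
  split_ifs <;> constructor <;> linarith

theorem leaderMap_iterate_of_mem_Icc (n : ℕ) {x : ℝ} (hx : x ∈ Icc (0:ℝ) (1/2)) :
    leaderMap^[n] x = x * (1/3) ^ n := by
  induction n generalizing x with
  | zero => simp
  | succ n ih =>
    obtain ⟨h0, h1⟩ := hx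
    have hT : leaderMap x = x / 3 := if_pos h1
    rw [Function.iterate_succ_apply, hT, ih ⟨by linarith, by linarith⟩]
    ring

/-- T is a Leader contraction on ([0,3/4], |·−·|): for each ε > 0 there exist δ > 0 and
r ∈ ℕ such that for all x, y ∈ [0,3/4], |x − y| < ε + δ implies |T^r x − T^r y| < ε. -/
theorem leaderMap_is_leader_contraction :
    ∀ ε > (0:ℝ), ∃ δ > (0:ℝ), ∃ r : ℕ,
      ∀ x ∈ Icc (0:ℝ) (3/4), ∀ y ∈ Icc (0:ℝ) (3/4),
        |x - y| < ε + δ → |leaderMap^[r] x - leaderMap^[r] y| < ε := by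
  intro ε hε
  obtain ⟨n, hn⟩ := exists_pow_lt_of_lt_one hε (by norm_num : (1/3 : ℝ) < 1)
  refine ⟨1, one_pos, n + 1, fun x hx y hy _ => ?_⟩
  have hx' := leaderMap_mem_Icc hx
  have hy' := leaderMap_mem_Icc hy
  have hp : (0:ℝ) < (1/3) ^ n := by positivity
  rw [Function.iterate_succ_apply, Function.iterate_succ_apply,
    leaderMap_iterate_of_mem_Icc n hx', leaderMap_iterate_of_mem_Icc n hy', ← sub_mul, abs_mul,
    abs_of_pos hp]
  have hd : |leaderMap x - leaderMap y| ≤ 1 :=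
    abs_le.2 ⟨by linarith [hx'.1, hy'.2], by linarith [hx'.2, hy'.1]⟩
  exact (mul_le_of_le_one_left hp.le hd).trans_lt hn
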